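/- Let P be a symmetric invertible real n×n matrix, let N ∈ ℕ, let c : ℕ → ℝ with c(0) = 1, and let f be a map from real n×n matrices to real n×n matrices such that for every symmetric matrix B and every integer k ≥ 1 the matrix (f(B))^k · B is symmetric. Define K(B) := (∑_{k=0}^{N} c(k)·(f(B))^k) · P. If a matrix A satisfies A = (1/2)(K(A) + K(A)ᵀ) and ‖I − P⁻¹·A‖ < 1 in the ℓ²-operator norm, then A = K(A); in particular A is a symmetric solution of the unsymmetrized fixed-point equation. -/

import Mathlib

open Matrix Finset

/-- The ℓ²-operator norm (spectral norm) of a real square matrix. -/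
noncomputable def l2OpNorm {n : ℕ} (B : Matrix (Fin n) (Fin n) ℝ) : ℝ :=
  ‖(Matrix.toEuclideanCLM (𝕜 := ℝ) B : EuclideanSpace ℝ (Fin n) →L[ℝ] EuclideanSpace ℝ (Fin n))‖

open scoped Matrix.Norms.L2Operator in
/-- The Sylvester equation `W * X + Xᵀ * W = 0` has only the trivial solution when `X` is within
distance less than `1` of the identity. -/
theorem eq_zero_of_mul_add_transpose_mul_eq_zero {n : ℕ} {W X : Matrix (Fin n) (Fin n) ℝ}
    (hX : l2OpNorm (1 - X) < 1) (h : W * X + Xᵀ * W = 0) : W = 0 := by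
  have hE : ‖1 - X‖ < 1 := hX
  have hET : ‖(1 - X)ᵀ‖ = ‖1 - X‖ := by
    rw [← conjTranspose_eq_transpose_of_trivial, l2_opNorm_conjTranspose]
  have hW : W + W = W * (1 - X) + (1 - X)ᵀ * W := by
    rw [transpose_sub, transpose_one, mul_sub, sub_mul, mul_one, one_mul,
      ← sub_eq_zero, ← h]
    abel
  have hle : ‖W + W‖ ≤ 2 * (‖1 - X‖ * ‖W‖) := by
    rw [hW]
    refine (norm_add_le _ _).trans ?_
    have h₁ := norm_mul_le W (1 - X)
    have h₂ := norm_mul_le (1 - X)ᵀ W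
    rw [hET] at h₂
    linarith
  have h₂ : ‖W + W‖ = 2 * ‖W‖ := by
    rw [← two_smul ℝ W, norm_smul, Real.norm_ofNat]
  rw [← norm_le_zero_iff]
  by_contra! hpos
  nlinarith

/-- Let `P` be a symmetric invertible real `n×n` matrix, `N ∈ ℕ`, `c : ℕ → ℝ` with
`c 0 = 1`, and `f` a map on matrices such that `(f B)^k * B` is symmetric for every symmetric `B`
and every `k ≥ 1`.  Define `K B := (∑ k in range (N+1), c k • (f B)^k) * P`.  If
`A = (1/2)(K A + (K A)ᵀ)` and `‖1 − P⁻¹·A‖ < 1` in the ℓ²-operator norm, then `A = K A`;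
in particular `A` is a symmetric solution of the unsymmetrized fixed-point equation. -/
theorem symmetrized_scheme_solves_unsymmetrized {n : ℕ}
    (P : Matrix (Fin n) (Fin n) ℝ) (hP : Pᵀ = P) (hPinv : IsUnit P)
    (N : ℕ) (c : ℕ → ℝ) (hc0 : c 0 = 1)
    (f : Matrix (Fin n) (Fin n) ℝ → Matrix (Fin n) (Fin n) ℝ)
    (hf : ∀ B : Matrix (Fin n) (Fin n) ℝ, Bᵀ = B → ∀ k : ℕ, 1 ≤ k →
      ((f B) ^ k * B)ᵀ = (f B) ^ k * B)
    (K : Matrix (Fin n) (Fin n) ℝ → Matrix (Fin n) (Fin n) ℝ)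
    (hK : ∀ B, K B = (∑ k ∈ Finset.range (N + 1), c k • (f B) ^ k) * P)
    (A : Matrix (Fin n) (Fin n) ℝ)
    (hA : A = (1 / 2 : ℝ) • (K A + (K A)ᵀ))
    (hnorm : l2OpNorm (1 - P⁻¹ * A) < 1) :
    A = K A ∧ Aᵀ = A := by
  have hAT : Aᵀ = A := by
    rw [hA, transpose_smul, transpose_add, transpose_transpose, add_comm]
  refine ⟨?_, hAT⟩
  have hdet : IsUnit P.det := (isUnit_iff_isUnit_det P).mp hPinv
  set S := ∑ k ∈ Finset.range (N + 1), c k • (f A) ^ k with hS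
  have hSA : (S * A)ᵀ = S * A := by
    rw [hS, Finset.sum_mul, transpose_sum]
    refine Finset.sum_congr rfl fun k _ => ?_
    rw [smul_mul_assoc, transpose_smul]
    rcases Nat.eq_zero_or_pos k with rfl | hk
    · rw [pow_zero, one_mul, hAT]
    · rw [hf A hAT k hk]
  have hKA : K A = S * P := hK A
  have hKP : K A * P⁻¹ = S := by rw [hKA, mul_nonsing_inv_cancel_right _ _ hdet]
  have hXT : (P⁻¹ * A)ᵀ = A * P⁻¹ := by
    rw [transpose_mul, transpose_nonsing_inv, hP, hAT]
  have hsum : K A + (K A)ᵀ = A + A := by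
    rw [← two_smul ℝ A]
    conv_rhs => rw [hA]
    rw [smul_smul]
    norm_num
  have hKT : (K A)ᵀ = A + A - K A := eq_sub_of_add_eq' hsum
  have hcomm : A * P⁻¹ * (A + A - K A) = K A * (P⁻¹ * A) := by
    rw [← hKT, ← mul_assoc (K A), hKP, ← hSA, ← hXT, ← transpose_mul, ← mul_assoc, hKP]
  refine (sub_eq_zero.mp (eq_zero_of_mul_add_transpose_mul_eq_zero hnorm ?_)).symm
  rw [hXT, sub_mul, ← hcomm]
  noncomm_ring
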